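/- arXiv:math/0202108 — 5 statements merged into one kernel-verified Lean document; each statement's English description precedes it below -/
import Mathlib

section
/- Let α, β ∈ M be strictly positive, and assume there are constants A, B ≥ 1 such that (1/A)·α(Bx) ≤ β(x) ≤ A·α(x/B) for all sufficiently large x. Then δ̲(α⊕β) = δ̲(α) = δ̲(β) and δ̄(α⊕β) = δ̄(α) = δ̄(β). -/
open Filter MeasureTheory

/-- `(1/log l)·limsup_{x→∞} log(μ(x)/μ(l·x))`, as an element of `[0,∞]`. -/
noncomputable def ratioSup (μ : ℝ → ℝ) (l : ℝ) : ENNReal :=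
  Filter.limsup (fun x : ℝ => ENNReal.ofReal (Real.log (μ x / μ (l * x)) / Real.log l))
    Filter.atTop

/-- `(1/log l)·liminf_{x→∞} log(μ(x)/μ(l·x))`, as an element of `[0,∞]`. -/
noncomputable def ratioInf (μ : ℝ → ℝ) (l : ℝ) : ENNReal :=
  Filter.liminf (fun x : ℝ => ENNReal.ofReal (Real.log (μ x / μ (l * x)) / Real.log l))
    Filter.atTop

/-- `d = δ̲(μ)`, with the conventions `1/0 = +∞`, `1/(+∞) = 0` (those of `ℝ≥0∞`). -/
def IsDeltaLow (μ : ℝ → ℝ) (d : ENNReal) : Prop :=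
  ∃ D : ENNReal, d = D⁻¹ ∧ Filter.Tendsto (ratioSup μ) Filter.atTop (nhds D)

/-- `d = δ̄(μ)`, with the conventions `1/0 = +∞`, `1/(+∞) = 0` (those of `ℝ≥0∞`). -/
def IsDeltaUp (μ : ℝ → ℝ) (d : ENNReal) : Prop :=
  ∃ D : ENNReal, d = D⁻¹ ∧ Filter.Tendsto (ratioInf μ) Filter.atTop (nhds D)

/-- The distribution function `λ_μ(t)` = Lebesgue measure of `{x ≥ 0 : μ(x) > t}`. -/
noncomputable def distr (μ : ℝ → ℝ) (t : ℝ) : ENNReal :=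
  volume {x : ℝ | 0 ≤ x ∧ t < μ x}

/-- The direct sum `α⊕β`, i.e. the non-increasing rearrangement with distribution
function `λ_α + λ_β`: `(α⊕β)(x) = inf{t ≥ 0 : λ_α(t) + λ_β(t) ≤ x}`. -/
noncomputable def dsum (α β : ℝ → ℝ) (x : ℝ) : ℝ :=
  sInf {t : ℝ | 0 ≤ t ∧ distr α t + distr β t ≤ ENNReal.ofReal x}

lemma ENNReal.limsup_add_le_add_limsup {ι : Type*} {f : Filter ι} (u v : ι → ENNReal) :
    limsup (fun x => u x + v x) f ≤ limsup u f + limsup v f := by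
  refine ENNReal.le_of_forall_pos_le_add fun ε hε hfin => ?_
  obtain ⟨hu, hv⟩ := ENNReal.add_lt_top.1 hfin
  have hε2 : (ε / 2 : ENNReal) ≠ 0 := by simpa using hε.ne'
  have h1 := eventually_lt_of_limsup_lt (ENNReal.lt_add_right hu.ne hε2)
  have h2 := eventually_lt_of_limsup_lt (ENNReal.lt_add_right hv.ne hε2)
  refine limsup_le_of_le (by isBoundedDefault) ?_
  filter_upwards [h1, h2] with x hx1 hx2
  calc u x + v x ≤ (limsup u f + ε / 2) + (limsup v f + ε / 2) := add_le_add hx1.le hx2.le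
    _ = limsup u f + limsup v f + ε := by
      rw [add_add_add_comm, ENNReal.add_halves]

lemma ENNReal.add_liminf_le_liminf_add {ι : Type*} {f : Filter ι} (u v : ι → ENNReal) :
    liminf u f + liminf v f ≤ liminf (fun x => u x + v x) f := by
  simp only [liminf_eq_iSup_iInf]
  refine ENNReal.biSup_add_biSup_le' ⟨_, univ_mem⟩ ⟨_, univ_mem⟩ fun s hs t ht => ?_
  refine le_iSup₂_of_le (s ∩ t) (inter_mem hs ht) (le_iInf₂ fun x hx => ?_)
  exact add_le_add (iInf₂_le x hx.1) (iInf₂_le x hx.2)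

lemma map_const_mul_atTop {c : ℝ} (hc : 0 < c) : map (fun x => c * x) atTop = atTop :=
  (OrderIso.mulLeft₀ c hc).map_atTop

/-- A nondecreasing subadditive function grows linearly, at the rate `inf F(L)/L`. -/
lemma exists_tendsto_div_of_subadditive {F : ℝ → ENNReal}
    (hmono : ∀ L M, 0 < L → L ≤ M → F L ≤ F M)
    (hsub : ∀ L M, 0 < L → 0 < M → F (L + M) ≤ F L + F M) :
    ∃ D, Tendsto (fun L => F L / ENNReal.ofReal L) atTop (nhds D) := by
  refine ⟨⨅ L : Set.Ioi (0 : ℝ), F L / ENNReal.ofReal L,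
    tendsto_of_le_liminf_of_limsup_le ?_ ?_⟩
  · refine le_liminf_of_le (by isBoundedDefault) ?_
    filter_upwards [eventually_gt_atTop 0] with L hL
    exact iInf_le (fun L : Set.Ioi (0 : ℝ) => F L / ENNReal.ofReal L) ⟨L, hL⟩
  · refine le_iInf fun ⟨K, hK⟩ => ?_
    replace hK : 0 < K := hK
    have hK0 : ENNReal.ofReal K ≠ 0 := by simpa using hK
    by_cases htop : F K = ⊤
    · simp [htop, ENNReal.top_div]
    have hmul : ∀ n : ℕ, F ((n + 1) * K) ≤ (n + 1) * F K := by
      intro n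
      induction n with
      | zero => simp
      | succ n ih =>
        have h1 : (((n + 1 : ℕ) : ℝ) + 1) * K = (n + 1) * K + K := by push_cast; ring
        rw [h1]
        refine (hsub _ _ (by positivity) hK).trans ?_
        push_cast
        rw [add_mul ((n : ENNReal) + 1), one_mul]
        gcongr
    have hbd : ∀ᶠ L in atTop, F L / ENNReal.ofReal L
        ≤ F K * ENNReal.ofReal (1 / K + 1 / L) := by
      filter_upwards [eventually_gt_atTop 0] with L hL
      have h1 : F L ≤ ENNReal.ofReal (L / K + 1) * F K := by
        have hlt := Nat.lt_floor_add_one (L / K)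
        have hle := Nat.floor_le (div_pos hL hK).le
        calc F L ≤ F ((⌊L / K⌋₊ + 1) * K) := hmono _ _ hL ((div_le_iff₀ hK).1 hlt.le)
          _ ≤ (⌊L / K⌋₊ + 1) * F K := hmul _
          _ = ENNReal.ofReal (⌊L / K⌋₊ + 1) * F K := by
            rw [ENNReal.ofReal_add (by positivity) (by positivity)]; simp
          _ ≤ _ := by gcongr
      refine ENNReal.div_le_of_le_mul (h1.trans_eq ?_)
      rw [mul_assoc, ← ENNReal.ofReal_mul (by positivity), mul_comm]
      congr 2
      field_simp
    have hlim : Tendsto (fun L : ℝ => F K * ENNReal.ofReal (1 / K + 1 / L)) atTop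
        (nhds (F K * ENNReal.ofReal (1 / K + 0))) := by
      refine ENNReal.Tendsto.const_mul (ENNReal.tendsto_ofReal ?_) (Or.inr htop)
      exact tendsto_const_nhds.add (tendsto_const_nhds.div_atTop tendsto_id)
    refine (limsup_le_limsup hbd).trans_eq (hlim.limsup_eq.trans ?_)
    rw [add_zero, one_div, ENNReal.ofReal_inv_of_pos hK, div_eq_mul_inv]

/-- A nondecreasing superadditive function grows linearly, at the rate `sup F(L)/L`. -/
lemma exists_tendsto_div_of_superadditive {F : ℝ → ENNReal}
    (hmono : ∀ L M, 0 < L → L ≤ M → F L ≤ F M)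
    (hsup : ∀ L M, 0 < L → 0 < M → F L + F M ≤ F (L + M)) :
    ∃ D, Tendsto (fun L => F L / ENNReal.ofReal L) atTop (nhds D) := by
  refine ⟨⨆ L : Set.Ioi (0 : ℝ), F L / ENNReal.ofReal L,
    tendsto_of_le_liminf_of_limsup_le ?_ ?_⟩
  · refine iSup_le fun ⟨K, hK⟩ => ?_
    replace hK : 0 < K := hK
    have hmul : ∀ n : ℕ, (n + 1) * F K ≤ F ((n + 1) * K) := by
      intro n
      induction n with
      | zero => simp
      | succ n ih =>
        have h1 : (((n + 1 : ℕ) : ℝ) + 1) * K = (n + 1) * K + K := by push_cast; ring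
        rw [h1]
        refine le_trans ?_ (hsup _ _ (by positivity) hK)
        push_cast
        rw [add_mul ((n : ENNReal) + 1), one_mul]
        gcongr
    have hbd : ∀ᶠ L in atTop, F K * ENNReal.ofReal (1 / K - 1 / L)
        ≤ F L / ENNReal.ofReal L := by
      filter_upwards [eventually_ge_atTop K] with L hL
      have hL0 : 0 < L := hK.trans_le hL
      have h1 : ENNReal.ofReal (L / K - 1) * F K ≤ F L := by
        obtain ⟨n, hn⟩ : ∃ n : ℕ, ⌊L / K⌋₊ = n + 1 :=
          Nat.exists_eq_add_one.2 (Nat.floor_pos.2 ((one_le_div hK).2 hL))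
        have hlt := Nat.lt_floor_add_one (L / K)
        have hle := Nat.floor_le (div_pos hL0 hK).le
        rw [hn] at hlt hle
        push_cast at hlt hle
        calc ENNReal.ofReal (L / K - 1) * F K ≤ ENNReal.ofReal (n + 1) * F K := by
              gcongr; linarith
          _ = (n + 1) * F K := by
            rw [ENNReal.ofReal_add (by positivity) (by positivity)]; simp
          _ ≤ F ((n + 1) * K) := hmul _
          _ ≤ F L := hmono _ _ (by positivity) ((le_div_iff₀ hK).1 hle)
      rw [ENNReal.le_div_iff_mul_le (by simp [hL0]) (by simp)]
      refine le_trans (le_of_eq ?_) h1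
      rw [mul_assoc, ← ENNReal.ofReal_mul' hL0.le, mul_comm]
      congr 2
      field_simp
    have hlim : Tendsto (fun L : ℝ => F K * ENNReal.ofReal (1 / K - 1 / L)) atTop
        (nhds (F K * ENNReal.ofReal (1 / K - 0))) := by
      refine ENNReal.Tendsto.const_mul (ENNReal.tendsto_ofReal ?_) (Or.inl (by simpa using hK))
      exact tendsto_const_nhds.sub (tendsto_const_nhds.div_atTop tendsto_id)
    refine le_trans (le_of_eq ?_) (hlim.liminf_eq.symm.trans_le (liminf_le_liminf hbd))
    rw [sub_zero, one_div, ENNReal.ofReal_inv_of_pos hK, div_eq_mul_inv]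
  · refine limsup_le_of_le (by isBoundedDefault) ?_
    filter_upwards [eventually_gt_atTop 0] with L hL
    exact le_iSup (fun L : Set.Ioi (0 : ℝ) => F L / ENNReal.ofReal L) ⟨L, hL⟩

/-- Shifting the argument and adding a finite constant do not change linear growth rates. -/
lemma le_of_tendsto_div_of_le_const_add_shift {F G : ℝ → ENNReal} {D E c : ENNReal} {b : ℝ}
    (hF : Tendsto (fun L => F L / ENNReal.ofReal L) atTop (nhds D))
    (hG : Tendsto (fun L => G L / ENNReal.ofReal L) atTop (nhds E)) (hc : c ≠ ⊤)
    (h : ∀ᶠ L in atTop, G L ≤ c + F (L + b)) : E ≤ D := by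
  have h1 : Tendsto (fun L => c / ENNReal.ofReal L) atTop (nhds (c / ⊤)) :=
    ENNReal.Tendsto.const_div ENNReal.tendsto_ofReal_atTop (Or.inr hc)
  have h2 : Tendsto (fun L : ℝ => ENNReal.ofReal (1 + b / L)) atTop
      (nhds (ENNReal.ofReal (1 + 0))) :=
    ENNReal.tendsto_ofReal
      (tendsto_const_nhds.add (tendsto_const_nhds.div_atTop tendsto_id))
  have h3 := hF.comp (tendsto_atTop_add_const_right atTop b tendsto_id)
  have h4 := h1.add (ENNReal.Tendsto.mul h3 (Or.inr (by simp)) h2 (Or.inl (by simp)))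
  rw [ENNReal.div_top, zero_add, add_zero, ENNReal.ofReal_one, mul_one] at h4
  refine le_of_tendsto_of_tendsto hG h4 ?_
  filter_upwards [h, eventually_gt_atTop 0, eventually_gt_atTop (-b)] with L hL hL0 hLb
  have hLb' : 0 < L + b := by linarith
  refine (ENNReal.div_le_div_right hL _).trans_eq ?_
  rw [ENNReal.add_div]
  congr 1
  have h5 : 1 + b / L = (L + b) * L⁻¹ := by field_simp
  simp only [Function.comp, id]
  rw [h5, ENNReal.ofReal_mul hLb'.le, ENNReal.ofReal_inv_of_pos hL0, ← mul_assoc,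
    ENNReal.div_mul_cancel (by simpa using hLb') (by simp), div_eq_mul_inv]

/-- The positive part of `log (μ(x)/μ(e^L x))`. -/
noncomputable def logDrop (μ : ℝ → ℝ) (L x : ℝ) : ENNReal :=
  ENNReal.ofReal (Real.log (μ x / μ (Real.exp L * x)))

lemma ofReal_log_ratio_eq {μ : ℝ → ℝ} {l : ℝ} (hl : 1 < l) (x : ℝ) :
    ENNReal.ofReal (Real.log (μ x / μ (l * x)) / Real.log l)
      = (ENNReal.ofReal (Real.log l))⁻¹ * logDrop μ (Real.log l) x := by
  rw [logDrop, Real.exp_log (by linarith), ENNReal.ofReal_div_of_pos (Real.log_pos hl),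
    div_eq_mul_inv, mul_comm]

lemma ratioSup_eq {μ : ℝ → ℝ} {l : ℝ} (hl : 1 < l) :
    ratioSup μ l = limsup (logDrop μ (Real.log l)) atTop / ENNReal.ofReal (Real.log l) := by
  have h : (ENNReal.ofReal (Real.log l))⁻¹ ≠ ⊤ := by simpa using Real.log_pos hl
  simp only [ratioSup, ofReal_log_ratio_eq hl]
  rw [ENNReal.limsup_const_mul_of_ne_top h, div_eq_mul_inv, mul_comm]

lemma ratioInf_eq {μ : ℝ → ℝ} {l : ℝ} (hl : 1 < l) :
    ratioInf μ l = liminf (logDrop μ (Real.log l)) atTop / ENNReal.ofReal (Real.log l) := by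
  have h : (ENNReal.ofReal (Real.log l))⁻¹ ≠ ⊤ := by simpa using Real.log_pos hl
  simp only [ratioInf, ofReal_log_ratio_eq hl]
  rw [ENNReal.liminf_const_mul_of_ne_top h, div_eq_mul_inv, mul_comm]

lemma tendsto_ratioSup {μ : ℝ → ℝ} {D : ENNReal}
    (h : Tendsto (fun L => limsup (logDrop μ L) atTop / ENNReal.ofReal L) atTop (nhds D)) :
    Tendsto (ratioSup μ) atTop (nhds D) := by
  refine (h.comp Real.tendsto_log_atTop).congr' ?_
  filter_upwards [eventually_gt_atTop 1] with l hl
  exact (ratioSup_eq hl).symm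

lemma tendsto_ratioInf {μ : ℝ → ℝ} {D : ENNReal}
    (h : Tendsto (fun L => liminf (logDrop μ L) atTop / ENNReal.ofReal L) atTop (nhds D)) :
    Tendsto (ratioInf μ) atTop (nhds D) := by
  refine (h.comp Real.tendsto_log_atTop).congr' ?_
  filter_upwards [eventually_gt_atTop 1] with l hl
  exact (ratioInf_eq hl).symm

lemma logDrop_mono {μ : ℝ → ℝ} (hpos : ∀ x, 0 ≤ x → 0 < μ x)
    (hanti : AntitoneOn μ (Set.Ici 0)) {L M x : ℝ} (hLM : L ≤ M) (hx : 0 ≤ x) :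
    logDrop μ L x ≤ logDrop μ M x := by
  have hL : 0 ≤ Real.exp L * x := by positivity
  have hM : 0 ≤ Real.exp M * x := by positivity
  refine ENNReal.ofReal_le_ofReal (Real.log_le_log (div_pos (hpos x hx) (hpos _ hL)) ?_)
  exact div_le_div_of_nonneg_left (hpos x hx).le (hpos _ hM) (hanti hL hM (by gcongr))

lemma logDrop_add {μ : ℝ → ℝ} (hpos : ∀ x, 0 ≤ x → 0 < μ x)
    (hanti : AntitoneOn μ (Set.Ici 0)) {L M x : ℝ} (hL : 0 ≤ L) (hM : 0 ≤ M)
    (hx : 0 ≤ x) :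
    logDrop μ (L + M) x = logDrop μ L x + logDrop μ M (Real.exp L * x) := by
  have key : ∀ {K y : ℝ}, 0 ≤ K → 0 ≤ y → 0 ≤ Real.log (μ y / μ (Real.exp K * y)) := by
    intro K y hK hy
    have hKy : 0 ≤ Real.exp K * y := by positivity
    refine Real.log_nonneg ((one_le_div (hpos _ hKy)).2 (hanti hy hKy ?_))
    exact le_mul_of_one_le_left hy (Real.one_le_exp hK)
  have hLx : 0 ≤ Real.exp L * x := by positivity
  have hMLx : 0 ≤ Real.exp M * (Real.exp L * x) := by positivity
  rw [logDrop, logDrop, logDrop, ← ENNReal.ofReal_add (key hL hx) (key hM hLx),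
    ← Real.log_mul (div_pos (hpos x hx) (hpos _ hLx)).ne'
      (div_pos (hpos _ hLx) (hpos _ hMLx)).ne',
    div_mul_div_cancel₀ (hpos _ hLx).ne', ← mul_assoc, ← Real.exp_add, add_comm M L]

lemma exists_tendsto_limsup_logDrop {μ : ℝ → ℝ} (hpos : ∀ x, 0 ≤ x → 0 < μ x)
    (hanti : AntitoneOn μ (Set.Ici 0)) :
    ∃ D, Tendsto (fun L => limsup (logDrop μ L) atTop / ENNReal.ofReal L) atTop (nhds D) := by
  refine exists_tendsto_div_of_subadditive (fun L M _ hLM => ?_) fun L M hL hM => ?_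
  · refine limsup_le_limsup ?_
    filter_upwards [eventually_ge_atTop 0] with x hx using logDrop_mono hpos hanti hLM hx
  · have h : logDrop μ (L + M) =ᶠ[atTop]
        fun x => logDrop μ L x + logDrop μ M (Real.exp L * x) := by
      filter_upwards [eventually_ge_atTop 0] with x hx using logDrop_add hpos hanti hL.le hM.le hx
    rw [limsup_congr h]
    refine (ENNReal.limsup_add_le_add_limsup _ _).trans_eq ?_
    congr 1
    conv_rhs => rw [← map_const_mul_atTop (Real.exp_pos L)]
    rfl

lemma exists_tendsto_liminf_logDrop {μ : ℝ → ℝ} (hpos : ∀ x, 0 ≤ x → 0 < μ x)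
    (hanti : AntitoneOn μ (Set.Ici 0)) :
    ∃ D, Tendsto (fun L => liminf (logDrop μ L) atTop / ENNReal.ofReal L) atTop (nhds D) := by
  refine exists_tendsto_div_of_superadditive (fun L M _ hLM => ?_) fun L M hL hM => ?_
  · refine liminf_le_liminf ?_
    filter_upwards [eventually_ge_atTop 0] with x hx using logDrop_mono hpos hanti hLM hx
  · have h : logDrop μ (L + M) =ᶠ[atTop]
        fun x => logDrop μ L x + logDrop μ M (Real.exp L * x) := by
      filter_upwards [eventually_ge_atTop 0] with x hx using logDrop_add hpos hanti hL.le hM.le hx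
    rw [liminf_congr h]
    refine le_trans (le_of_eq ?_) (ENNReal.add_liminf_le_liminf_add _ _)
    congr 1
    conv_lhs => rw [← map_const_mul_atTop (Real.exp_pos L)]
    rfl

/-- `ν` lies between rescalings of `μ` near infinity. -/
def TangentiallyComparable (A B : ℝ) (μ ν : ℝ → ℝ) : Prop :=
  ∀ᶠ x in atTop, (1 / A) * μ (B * x) ≤ ν x ∧ ν x ≤ A * μ (x / B)

lemma TangentiallyComparable.symm {A B : ℝ} {μ ν : ℝ → ℝ} (hA : 0 < A) (hB : 0 < B)
    (h : TangentiallyComparable A B μ ν) : TangentiallyComparable A B ν μ := by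
  have h1 := (tendsto_id.const_mul_atTop hB).eventually h
  have h2 := (tendsto_id.atTop_div_const hB).eventually h
  filter_upwards [h1, h2] with x hx1 hx2
  simp only [id] at hx1 hx2
  rw [mul_div_cancel_left₀ _ hB.ne'] at hx1
  rw [mul_div_cancel₀ _ hB.ne'] at hx2
  constructor
  · rw [one_div, inv_mul_le_iff₀ hA]
    exact hx1.2
  · have := hx2.1
    rwa [one_div, inv_mul_le_iff₀ hA] at this

section Comparison

variable {μ ν : ℝ → ℝ} {A B : ℝ}

lemma TangentiallyComparable.eventually_logDrop_le (h : TangentiallyComparable A B μ ν)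
    (hμ : ∀ x, 0 ≤ x → 0 < μ x) (hν : ∀ x, 0 ≤ x → 0 < ν x) (hA : 0 < A) (hB : 0 < B) (L : ℝ) :
    ∀ᶠ x in atTop, logDrop ν L x ≤ ENNReal.ofReal (2 * Real.log A)
      + logDrop μ (L + 2 * Real.log B) (B⁻¹ * x) := by
  have h1 := (tendsto_id.const_mul_atTop (Real.exp_pos L)).eventually h
  filter_upwards [h, h1, eventually_ge_atTop 0] with x hx hx1 hx0
  simp only [id] at hx1
  have e1 : Real.exp (L + 2 * Real.log B) * (B⁻¹ * x) = B * (Real.exp L * x) := by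
    rw [Real.exp_add, two_mul, Real.exp_add, Real.exp_log hB]
    field_simp
  have e2 : x / B = B⁻¹ * x := by rw [div_eq_mul_inv, mul_comm]
  rw [e2] at hx
  have p1 : 0 < μ (B⁻¹ * x) := hμ _ (by positivity)
  have p2 : 0 < μ (B * (Real.exp L * x)) := hμ _ (by positivity)
  have p3 : 0 < ν (Real.exp L * x) := hν _ (by positivity)
  rw [logDrop, logDrop, e1]
  refine le_trans (ENNReal.ofReal_le_ofReal ?_) ENNReal.ofReal_add_le
  calc Real.log (ν x / ν (Real.exp L * x))
      ≤ Real.log ((A * μ (B⁻¹ * x)) / ((1 / A) * μ (B * (Real.exp L * x)))) := by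
        refine Real.log_le_log (div_pos (hν x hx0) p3) ?_
        exact div_le_div₀ (by positivity) hx.2 (by positivity) hx1.1
    _ = Real.log (A * A * (μ (B⁻¹ * x) / μ (B * (Real.exp L * x)))) := by
        congr 1; field_simp
    _ = _ := by
        rw [Real.log_mul (by positivity) (by positivity), Real.log_mul hA.ne' hA.ne']
        ring

lemma TangentiallyComparable.limsup_logDrop_le (h : TangentiallyComparable A B μ ν)
    (hμ : ∀ x, 0 ≤ x → 0 < μ x) (hν : ∀ x, 0 ≤ x → 0 < ν x) (hA : 0 < A) (hB : 0 < B) (L : ℝ) :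
    limsup (logDrop ν L) atTop ≤ ENNReal.ofReal (2 * Real.log A)
      + limsup (logDrop μ (L + 2 * Real.log B)) atTop := by
  refine (limsup_le_limsup (h.eventually_logDrop_le hμ hν hA hB L)).trans_eq ?_
  rw [limsup_const_add _ _ _ (by isBoundedDefault) (by isBoundedDefault)]
  congr 1
  conv_rhs => rw [← map_const_mul_atTop (inv_pos.2 hB)]
  rfl

lemma TangentiallyComparable.liminf_logDrop_le (h : TangentiallyComparable A B μ ν)
    (hμ : ∀ x, 0 ≤ x → 0 < μ x) (hν : ∀ x, 0 ≤ x → 0 < ν x) (hA : 0 < A) (hB : 0 < B) (L : ℝ) :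
    liminf (logDrop ν L) atTop ≤ ENNReal.ofReal (2 * Real.log A)
      + liminf (logDrop μ (L + 2 * Real.log B)) atTop := by
  refine (liminf_le_liminf (h.eventually_logDrop_le hμ hν hA hB L)).trans_eq ?_
  rw [liminf_const_add _ _ _ (by isBoundedDefault) (by isBoundedDefault)]
  congr 1
  conv_rhs => rw [← map_const_mul_atTop (inv_pos.2 hB)]
  rfl

lemma TangentiallyComparable.isDeltaLow_and_isDeltaUp (h : TangentiallyComparable A B μ ν)
    (hμ : ∀ x, 0 ≤ x → 0 < μ x) (hν : ∀ x, 0 ≤ x → 0 < ν x)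
    (hμanti : AntitoneOn μ (Set.Ici 0)) (hνanti : AntitoneOn ν (Set.Ici 0))
    (hA : 0 < A) (hB : 0 < B) :
    (∃ d, IsDeltaLow μ d ∧ IsDeltaLow ν d) ∧ ∃ d, IsDeltaUp μ d ∧ IsDeltaUp ν d := by
  have h' := h.symm hA hB
  constructor
  · obtain ⟨D, hD⟩ := exists_tendsto_limsup_logDrop hμ hμanti
    obtain ⟨E, hE⟩ := exists_tendsto_limsup_logDrop hν hνanti
    obtain rfl : D = E := le_antisymm
      (le_of_tendsto_div_of_le_const_add_shift hE hD ENNReal.ofReal_ne_top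
        (.of_forall (h'.limsup_logDrop_le hν hμ hA hB)))
      (le_of_tendsto_div_of_le_const_add_shift hD hE ENNReal.ofReal_ne_top
        (.of_forall (h.limsup_logDrop_le hμ hν hA hB)))
    exact ⟨D⁻¹, ⟨D, rfl, tendsto_ratioSup hD⟩, D, rfl, tendsto_ratioSup hE⟩
  · obtain ⟨D, hD⟩ := exists_tendsto_liminf_logDrop hμ hμanti
    obtain ⟨E, hE⟩ := exists_tendsto_liminf_logDrop hν hνanti
    obtain rfl : D = E := le_antisymm
      (le_of_tendsto_div_of_le_const_add_shift hE hD ENNReal.ofReal_ne_top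
        (.of_forall (h'.liminf_logDrop_le hν hμ hA hB)))
      (le_of_tendsto_div_of_le_const_add_shift hD hE ENNReal.ofReal_ne_top
        (.of_forall (h.liminf_logDrop_le hμ hν hA hB)))
    exact ⟨D⁻¹, ⟨D, rfl, tendsto_ratioInf hD⟩, D, rfl, tendsto_ratioInf hE⟩

end Comparison

lemma IsDeltaLow.unique {μ : ℝ → ℝ} {d e : ENNReal} (hd : IsDeltaLow μ d) (he : IsDeltaLow μ e) :
    d = e := by
  obtain ⟨D, rfl, hD⟩ := hd
  obtain ⟨E, rfl, hE⟩ := he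
  rw [tendsto_nhds_unique hD hE]

lemma IsDeltaUp.unique {μ : ℝ → ℝ} {d e : ENNReal} (hd : IsDeltaUp μ d) (he : IsDeltaUp μ e) :
    d = e := by
  obtain ⟨D, rfl, hD⟩ := hd
  obtain ⟨E, rfl, hE⟩ := he
  rw [tendsto_nhds_unique hD hE]

lemma distr_le_of_antitoneOn {μ : ℝ → ℝ} (hanti : AntitoneOn μ (Set.Ici 0)) {t x : ℝ}
    (hx : 0 ≤ x) (ht : μ x ≤ t) : distr μ t ≤ ENNReal.ofReal x := by
  calc distr μ t ≤ volume (Set.Ico 0 x) := measure_mono fun y hy => ⟨hy.1, by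
        by_contra! hxy
        exact absurd (hanti hx hy.1 hxy) (not_le.2 (ht.trans_lt hy.2))⟩
    _ = ENNReal.ofReal x := by simp

lemma le_of_distr_lt {μ : ℝ → ℝ} (hanti : AntitoneOn μ (Set.Ici 0)) {t x : ℝ}
    (h : distr μ t < ENNReal.ofReal x) : μ x ≤ t := by
  by_contra! ht
  refine absurd h (not_lt.2 ?_)
  calc ENNReal.ofReal x = volume (Set.Ico 0 x) := by simp
    _ ≤ distr μ t := measure_mono fun y hy =>
      ⟨hy.1, ht.trans_le (hanti hy.1 (hy.1.trans hy.2.le) hy.2.le)⟩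

section DirectSum

variable {α β : ℝ → ℝ}

lemma bddBelow_dsum_set (x : ℝ) :
    BddBelow {t : ℝ | 0 ≤ t ∧ distr α t + distr β t ≤ ENNReal.ofReal x} :=
  ⟨0, fun _ ht => ht.1⟩

lemma max_mem_dsum_set (hposα : ∀ x : ℝ, 0 ≤ x → 0 < α x)
    (hantiα : AntitoneOn α (Set.Ici 0)) (hantiβ : AntitoneOn β (Set.Ici 0)) {x : ℝ}
    (hx : 0 ≤ x) :
    max (α (x / 2)) (β (x / 2)) ∈
      {t : ℝ | 0 ≤ t ∧ distr α t + distr β t ≤ ENNReal.ofReal x} := by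
  have hx2 : 0 ≤ x / 2 := by positivity
  refine ⟨(hposα _ hx2).le.trans (le_max_left _ _), ?_⟩
  calc _ ≤ ENNReal.ofReal (x / 2) + ENNReal.ofReal (x / 2) :=
        add_le_add (distr_le_of_antitoneOn hantiα hx2 (le_max_left _ _))
          (distr_le_of_antitoneOn hantiβ hx2 (le_max_right _ _))
    _ = ENNReal.ofReal x := by rw [← ENNReal.ofReal_add hx2 hx2, add_halves]

lemma dsum_le_max (hposα : ∀ x : ℝ, 0 ≤ x → 0 < α x)
    (hantiα : AntitoneOn α (Set.Ici 0)) (hantiβ : AntitoneOn β (Set.Ici 0)) {x : ℝ}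
    (hx : 0 ≤ x) : dsum α β x ≤ max (α (x / 2)) (β (x / 2)) :=
  csInf_le (bddBelow_dsum_set x) (max_mem_dsum_set hposα hantiα hantiβ hx)

lemma le_dsum (hposα : ∀ x : ℝ, 0 ≤ x → 0 < α x)
    (hantiα : AntitoneOn α (Set.Ici 0)) (hantiβ : AntitoneOn β (Set.Ici 0)) {x y : ℝ}
    (hx : 0 ≤ x) (hxy : x < y) : α y ≤ dsum α β x :=
  le_csInf ⟨_, max_mem_dsum_set hposα hantiα hantiβ hx⟩ fun _ ht =>
    le_of_distr_lt hantiα ((le_self_add.trans ht.2).trans_lt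
      ((ENNReal.ofReal_lt_ofReal_iff (hx.trans_lt hxy)).2 hxy))

lemma dsum_pos (hposα : ∀ x : ℝ, 0 ≤ x → 0 < α x)
    (hantiα : AntitoneOn α (Set.Ici 0)) (hantiβ : AntitoneOn β (Set.Ici 0)) {x : ℝ}
    (hx : 0 ≤ x) : 0 < dsum α β x :=
  (hposα (x + 1) (by positivity)).trans_le (le_dsum hposα hantiα hantiβ hx (lt_add_one x))

lemma antitoneOn_dsum (hposα : ∀ x : ℝ, 0 ≤ x → 0 < α x)
    (hantiα : AntitoneOn α (Set.Ici 0)) (hantiβ : AntitoneOn β (Set.Ici 0)) :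
    AntitoneOn (dsum α β) (Set.Ici 0) := fun _ hx _ _ hxy =>
  csInf_le_csInf (bddBelow_dsum_set _) ⟨_, max_mem_dsum_set hposα hantiα hantiβ hx⟩
    fun _ ht => ⟨ht.1, ht.2.trans (ENNReal.ofReal_le_ofReal hxy)⟩

lemma TangentiallyComparable.dsum (hposα : ∀ x : ℝ, 0 ≤ x → 0 < α x)
    (hantiα : AntitoneOn α (Set.Ici 0)) (hantiβ : AntitoneOn β (Set.Ici 0))
    {A B : ℝ} (h : TangentiallyComparable A B α β) (hA : 1 ≤ A) (hB : 1 ≤ B) :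
    TangentiallyComparable A (2 * B) α (dsum α β) := by
  have h2 := (tendsto_id.atTop_div_const (two_pos (α := ℝ))).eventually h
  filter_upwards [h2, eventually_gt_atTop 0] with x hx hx0
  simp only [id, div_div] at hx
  have hα : 0 < α (2 * B * x) := hposα _ (by positivity)
  have hα' : 0 < α (x / (2 * B)) := hposα _ (by positivity)
  constructor
  · calc 1 / A * α (2 * B * x) ≤ α (2 * B * x) :=
          mul_le_of_le_one_left hα.le ((div_le_one (by positivity)).2 hA)
      _ ≤ _ := le_dsum hposα hantiα hantiβ hx0.le (by nlinarith)
  · refine (dsum_le_max hposα hantiα hantiβ hx0.le).trans (max_le ?_ hx.2)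
    calc α (x / 2) ≤ α (x / (2 * B)) := by
          refine hantiα (Set.mem_Ici.2 (by positivity)) (Set.mem_Ici.2 (by positivity)) ?_
          exact div_le_div_of_nonneg_left hx0.le two_pos (by linarith)
      _ ≤ _ := le_mul_of_one_le_left hα'.le hA

end DirectSum

/-- Proposition 1.12 (`dim.tang.eq`): let `α, β ∈ M` be strictly positive, and assume there
are `A, B ≥ 1` with `(1/A)·α(Bx) ≤ β(x) ≤ A·α(x/B)` for all `x` large enough. Then
`δ̲(α⊕β) = δ̲(α) = δ̲(β)` and `δ̄(α⊕β) = δ̄(α) = δ̄(β)`. -/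
theorem stmt10 (α β : ℝ → ℝ)
    (hposα : ∀ x : ℝ, 0 ≤ x → 0 < α x) (hposβ : ∀ x : ℝ, 0 ≤ x → 0 < β x)
    (hantiα : AntitoneOn α (Set.Ici 0)) (hantiβ : AntitoneOn β (Set.Ici 0))
    (hrcα : ∀ x : ℝ, 0 ≤ x → ContinuousWithinAt α (Set.Ici x) x)
    (hrcβ : ∀ x : ℝ, 0 ≤ x → ContinuousWithinAt β (Set.Ici x) x)
    (hlimα : Tendsto α atTop (nhds 0)) (hlimβ : Tendsto β atTop (nhds 0))
    (A B : ℝ) (hA : 1 ≤ A) (hB : 1 ≤ B)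
    (hcomp : ∀ᶠ x in atTop, (1 / A) * α (B * x) ≤ β x ∧ β x ≤ A * α (x / B)) :
    (∃ d : ENNReal, IsDeltaLow (dsum α β) d ∧ IsDeltaLow α d ∧ IsDeltaLow β d) ∧
    (∃ d : ENNReal, IsDeltaUp (dsum α β) d ∧ IsDeltaUp α d ∧ IsDeltaUp β d) := by
  have hA0 : 0 < A := one_pos.trans_le hA
  have hB0 : 0 < B := one_pos.trans_le hB
  have hαβ : TangentiallyComparable A B α β := hcomp
  obtain ⟨⟨d, hd, hd'⟩, e, he, he'⟩ :=
    hαβ.isDeltaLow_and_isDeltaUp hposα hposβ hantiα hantiβ hA0 hB0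
  obtain ⟨⟨d₂, hd₂, hd₂'⟩, e₂, he₂, he₂'⟩ :=
    (hαβ.dsum hposα hantiα hantiβ hA hB).isDeltaLow_and_isDeltaUp hposα
      (fun _ hx => dsum_pos hposα hantiα hantiβ hx) hantiα
      (antitoneOn_dsum hposα hantiα hantiβ) hA0 (by positivity)
  obtain rfl := hd.unique hd₂
  obtain rfl := he.unique he₂
  exact ⟨⟨d, hd₂', hd, hd'⟩, e, he₂', he, he'⟩
end

section
/- Let α₁, α₂ > 0 and let (λ_i)_{i∈ℕ}, (κ_j)_{j∈ℕ} be sequences of positive real numbers with Σ_i λ_i^{−α₁} < ∞ and Σ_j κ_j^{−α₂} < ∞. Then Σ_{i,j} (λ_i² + κ_j²)^{−(α₁+α₂)/2} ≤ (Σ_i λ_i^{−α₁})·(Σ_j κ_j^{−α₂}); in particular the double series converges. (This expresses that the dimension of the tensor product of two spectral triples is at most the sum of their dimensions: the eigenvalues of D² for the tensor product triple are the numbers λ_i² + κ_j², where λ_i, κ_j are the eigenvalues of |D₁| and |D₂|.) -/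
open Filter

/-- Pointwise comparison: dropping one of the two squares only increases a negative power. -/
theorem rpow_sq_add_sq_le_mul {a b s t : ℝ} (ha : 0 < a) (hb : 0 < b) (hs : 0 ≤ s) (ht : 0 ≤ t) :
    (a ^ 2 + b ^ 2) ^ (-(s + t) / 2) ≤ a ^ (-s) * b ^ (-t) := by
  have rpow_sq_half {x : ℝ} (hx : 0 < x) (r : ℝ) : (x ^ 2) ^ (-r / 2) = x ^ (-r) := by
    rw [← Real.rpow_natCast_mul hx.le]
    congr 1
    push_cast
    ring
  have hsplit : -(s + t) / 2 = -s / 2 + -t / 2 := by ring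
  rw [hsplit, Real.rpow_add (by positivity), ← rpow_sq_half ha, ← rpow_sq_half hb]
  refine mul_le_mul ?_ ?_ (by positivity) (by positivity)
  · exact Real.rpow_le_rpow_of_nonpos (by positivity) (by nlinarith) (by linarith)
  · exact Real.rpow_le_rpow_of_nonpos (by positivity) (by nlinarith) (by linarith)

/-- The summability estimate behind the subadditivity of the dimension under tensor
products of spectral triples: if `α₁, α₂ > 0`, `(λ_i)`, `(κ_j)` are positive sequences
with `Σ λ_i^{-α₁} < ∞` and `Σ κ_j^{-α₂} < ∞`, then the double series
`Σ_{i,j} (λ_i² + κ_j²)^{-(α₁+α₂)/2}` converges, and is bounded by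
`(Σ λ_i^{-α₁})·(Σ κ_j^{-α₂})`. -/
theorem stmt11 (α₁ α₂ : ℝ) (hα₁ : 0 < α₁) (hα₂ : 0 < α₂)
    (l κ : ℕ → ℝ) (hl : ∀ i, 0 < l i) (hκ : ∀ j, 0 < κ j)
    (hsl : Summable fun i => l i ^ (-α₁))
    (hsκ : Summable fun j => κ j ^ (-α₂)) :
    (Summable fun p : ℕ × ℕ => (l p.1 ^ 2 + κ p.2 ^ 2) ^ (-(α₁ + α₂) / 2)) ∧
    (∑' p : ℕ × ℕ, (l p.1 ^ 2 + κ p.2 ^ 2) ^ (-(α₁ + α₂) / 2)) ≤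
      (∑' i, l i ^ (-α₁)) * (∑' j, κ j ^ (-α₂)) := by
  have hle (p : ℕ × ℕ) : (l p.1 ^ 2 + κ p.2 ^ 2) ^ (-(α₁ + α₂) / 2) ≤
      l p.1 ^ (-α₁) * κ p.2 ^ (-α₂) :=
    rpow_sq_add_sq_le_mul (hl p.1) (hκ p.2) hα₁.le hα₂.le
  have hprod : Summable fun p : ℕ × ℕ => l p.1 ^ (-α₁) * κ p.2 ^ (-α₂) :=
    hsl.mul_of_nonneg hsκ (fun i => Real.rpow_nonneg (hl i).le _)
      (fun j => Real.rpow_nonneg (hκ j).le _)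
  have hsum := Summable.of_nonneg_of_le (fun p => by positivity) hle hprod
  refine ⟨hsum, ?_⟩
  rw [hsl.tsum_mul_tsum hsκ hprod]
  exact hsum.tsum_le_tsum hle hprod
end

section
/- Let μ ∈ M be strictly positive and suppose that lim_{x→∞} μ(x)/μ(2x) = L exists with L ∈ (1,∞). Then δ̲(μ) = δ̄(μ) = log 2 / log L; consequently, by the characterization of eccentricity exponents, log 2 / log L is the unique γ > 0 such that μ^γ is eccentric. -/
open Filter MeasureTheory
open scoped Classical

/-- The integral function `S_μ`: `S_μ(x) = ∫_x^∞ μ` if `μ` is integrable on `(0,∞)`,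
and `S_μ(x) = ∫_0^x μ` otherwise. -/
noncomputable def Sfun (μ : ℝ → ℝ) (x : ℝ) : ℝ :=
  if IntegrableOn μ (Set.Ioi (0:ℝ)) then ∫ t in Set.Ioi x, μ t
  else ∫ t in Set.Ioc (0:ℝ) x, μ t

/-- `μ` is eccentric if for some `l > 1`, `1` is a limit point as `x → ∞`
of `x ↦ S_μ(l·x)/S_μ(x)`. -/
def Eccentric (μ : ℝ → ℝ) : Prop :=
  ∃ l : ℝ, 1 < l ∧ MapClusterPt (1:ℝ) Filter.atTop (fun x => Sfun μ (l * x) / Sfun μ x)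

theorem tendsto_log_ratio_two_pow {μ : ℝ → ℝ} (hpos : ∀ x : ℝ, 0 ≤ x → 0 < μ x) {L : ℝ}
    (hL : 0 < L) (hratio : Tendsto (fun x : ℝ => μ x / μ (2 * x)) atTop (nhds L)) (n : ℕ) :
    Tendsto (fun x : ℝ => Real.log (μ x / μ (2 ^ n * x))) atTop (nhds (n * Real.log L)) := by
  induction n with
  | zero =>
    refine (tendsto_const_nhds (x := (0 : ℝ))).congr' ?_ |>.trans (by simp)
    filter_upwards [eventually_ge_atTop 0] with x hx
    simp [div_self (hpos x hx).ne']
  | succ n ih =>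
    have hscale : Tendsto (fun x : ℝ => 2 ^ n * x) atTop atTop :=
      tendsto_id.const_mul_atTop (by positivity)
    have hlog := (hratio.comp hscale).log hL.ne'
    have hsum := ih.add hlog
    have hval : (n : ℝ) * Real.log L + Real.log L = (n + 1 : ℕ) * Real.log L := by
      push_cast; ring
    rw [hval] at hsum
    refine hsum.congr' ?_
    filter_upwards [eventually_ge_atTop 0] with x hx
    have h0 := hpos x hx
    have h1 := hpos (2 ^ n * x) (by positivity)
    have h2 := hpos (2 * (2 ^ n * x)) (by positivity)
    have he : (2 : ℝ) ^ (n + 1) * x = 2 * (2 ^ n * x) := by ring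
    simp only [Function.comp]
    rw [he, ← Real.log_mul (by positivity) (by positivity)]
    congr 1
    field_simp

theorem eventually_log_ratio_bounds {μ : ℝ → ℝ} (hpos : ∀ x : ℝ, 0 ≤ x → 0 < μ x)
    (hanti : AntitoneOn μ (Set.Ici 0)) {L : ℝ} (hL : 1 < L)
    (hratio : Tendsto (fun x : ℝ => μ x / μ (2 * x)) atTop (nhds L)) {l : ℝ} (hl : 1 < l) :
    ∀ᶠ x in atTop,
      Real.log L / Real.log 2 - (Real.log L + 1) / Real.log l ≤
          Real.log (μ x / μ (l * x)) / Real.log l ∧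
        Real.log (μ x / μ (l * x)) / Real.log l ≤
          Real.log L / Real.log 2 + (Real.log L + 1) / Real.log l := by
  obtain ⟨n, hn1, hn2⟩ := exists_nat_pow_near hl.le (one_lt_two (α := ℝ))
  have hlogl := Real.log_pos hl
  have hlogL := Real.log_pos hL
  have hlog2 := Real.log_pos (one_lt_two (α := ℝ))
  have hL0 : 0 < L := by linarith
  have hc1 : n * Real.log 2 ≤ Real.log l := by
    rw [← Real.log_pow]; exact Real.log_le_log (by positivity) hn1
  have hc2 : Real.log l ≤ (n + 1 : ℕ) * Real.log 2 := by
    rw [← Real.log_pow]; exact Real.log_le_log (by positivity) hn2.le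
  push_cast at hc2
  have ha : Real.log L / Real.log 2 * Real.log 2 = Real.log L := by field_simp
  have ha0 : 0 < Real.log L / Real.log 2 := by positivity
  set a := Real.log L / Real.log 2
  have hA := (tendsto_log_ratio_two_pow hpos hL0 hratio n).eventually
    (lt_mem_nhds (show n * Real.log L - 1 < n * Real.log L by linarith))
  have hB := (tendsto_log_ratio_two_pow hpos hL0 hratio (n + 1)).eventually
    (gt_mem_nhds (show ((n + 1 : ℕ) : ℝ) * Real.log L < (n + 1 : ℕ) * Real.log L + 1 by linarith))
  filter_upwards [hA, hB, eventually_ge_atTop 0] with x h1 h2 hx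
  have p0 := hpos x hx
  have p1 := hpos (2 ^ n * x) (by positivity)
  have p2 := hpos (l * x) (by positivity)
  have p3 := hpos (2 ^ (n + 1) * x) (by positivity)
  have m1 : μ (l * x) ≤ μ (2 ^ n * x) := hanti (by simp; positivity) (by simp; positivity)
    (by gcongr)
  have m2 : μ (2 ^ (n + 1) * x) ≤ μ (l * x) := hanti (by simp; positivity) (by simp; positivity)
    (by gcongr)
  have l1 : Real.log (μ x / μ (2 ^ n * x)) ≤ Real.log (μ x / μ (l * x)) :=
    Real.log_le_log (by positivity) (by gcongr)
  have l2 : Real.log (μ x / μ (l * x)) ≤ Real.log (μ x / μ (2 ^ (n + 1) * x)) :=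
    Real.log_le_log (by positivity) (by gcongr)
  push_cast at h2
  constructor
  · rw [le_div_iff₀ hlogl, sub_mul, div_mul_cancel₀ _ hlogl.ne']
    nlinarith [mul_le_mul_of_nonneg_left hc2 ha0.le]
  · rw [div_le_iff₀ hlogl, add_mul, div_mul_cancel₀ _ hlogl.ne']
    nlinarith [mul_le_mul_of_nonneg_left hc1 ha0.le]

theorem tendsto_ratioInf_and_ratioSup {μ : ℝ → ℝ} (hpos : ∀ x : ℝ, 0 ≤ x → 0 < μ x)
    (hanti : AntitoneOn μ (Set.Ici 0)) {L : ℝ} (hL : 1 < L)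
    (hratio : Tendsto (fun x : ℝ => μ x / μ (2 * x)) atTop (nhds L)) :
    Tendsto (ratioInf μ) atTop (nhds (ENNReal.ofReal (Real.log L / Real.log 2))) ∧
      Tendsto (ratioSup μ) atTop (nhds (ENNReal.ofReal (Real.log L / Real.log 2))) := by
  have herr : Tendsto (fun l : ℝ => (Real.log L + 1) / Real.log l) atTop (nhds 0) :=
    Real.tendsto_log_atTop.const_div_atTop _
  have hlow := ENNReal.tendsto_ofReal (herr.const_sub (Real.log L / Real.log 2))
  have hup := ENNReal.tendsto_ofReal (herr.const_add (Real.log L / Real.log 2))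
  rw [sub_zero] at hlow
  rw [add_zero] at hup
  have hle : ∀ l, ratioInf μ l ≤ ratioSup μ l := fun l => liminf_le_limsup
  have hge : ∀ᶠ l in atTop, ENNReal.ofReal
      (Real.log L / Real.log 2 - (Real.log L + 1) / Real.log l) ≤ ratioInf μ l := by
    filter_upwards [eventually_gt_atTop 1] with l hl
    refine le_liminf_of_le (by isBoundedDefault) ?_
    filter_upwards [eventually_log_ratio_bounds hpos hanti hL hratio hl] with x hx
    exact ENNReal.ofReal_le_ofReal hx.1
  have hls : ∀ᶠ l in atTop, ratioSup μ l ≤ ENNReal.ofReal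
      (Real.log L / Real.log 2 + (Real.log L + 1) / Real.log l) := by
    filter_upwards [eventually_gt_atTop 1] with l hl
    refine limsup_le_of_le (by isBoundedDefault) ?_
    filter_upwards [eventually_log_ratio_bounds hpos hanti hL hratio hl] with x hx
    exact ENNReal.ofReal_le_ofReal hx.2
  exact ⟨tendsto_of_tendsto_of_tendsto_of_le_of_le' hlow hup hge
      (hls.mono fun l h => (hle l).trans h),
    tendsto_of_tendsto_of_tendsto_of_le_of_le' hlow hup
      (hge.mono fun l h => h.trans (hle l)) hls⟩

theorem AntitoneOn.integrableOn_Ioc_of_nonneg {f : ℝ → ℝ} (hanti : AntitoneOn f (Set.Ici 0))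
    {x y : ℝ} (hx : 0 ≤ x) : IntegrableOn f (Set.Ioc x y) :=
  ((hanti.mono fun _ h => Set.mem_Ici.2 (hx.trans h.1)).integrableOn_isCompact
    isCompact_Icc).mono_set Set.Ioc_subset_Icc_self

theorem abs_Sfun_sub {f : ℝ → ℝ} (hpos : ∀ x : ℝ, 0 ≤ x → 0 < f x)
    (hanti : AntitoneOn f (Set.Ici 0)) {x y : ℝ} (hx : 0 ≤ x) (hxy : x ≤ y) :
    |Sfun f y - Sfun f x| = ∫ t in Set.Ioc x y, f t := by
  have hnn : 0 ≤ ∫ t in Set.Ioc x y, f t :=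
    setIntegral_nonneg measurableSet_Ioc fun t ht => (hpos t (hx.trans ht.1.le)).le
  unfold Sfun
  split_ifs with h
  · have : ∫ t in Set.Ioi x, f t = (∫ t in Set.Ioc x y, f t) + ∫ t in Set.Ioi y, f t := by
      rw [← Set.Ioc_union_Ioi_eq_Ioi hxy, setIntegral_union Set.Ioc_disjoint_Ioi_same
        measurableSet_Ioi (hanti.integrableOn_Ioc_of_nonneg hx)
        (h.mono_set (Set.Ioi_subset_Ioi (hx.trans hxy)))]
    rw [this, abs_sub_comm, add_sub_cancel_right, abs_of_nonneg hnn]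
  · have : ∫ t in Set.Ioc 0 y, f t =
        (∫ t in Set.Ioc 0 x, f t) + ∫ t in Set.Ioc x y, f t := by
      rw [← Set.Ioc_union_Ioc_eq_Ioc hx hxy, setIntegral_union
        (Set.Ioc_disjoint_Ioc_of_le le_rfl)
        measurableSet_Ioc (hanti.integrableOn_Ioc_of_nonneg le_rfl)
        (hanti.integrableOn_Ioc_of_nonneg hx)]
    rw [this, add_sub_cancel_left, abs_of_nonneg hnn]

theorem abs_Sfun_sub_le {f : ℝ → ℝ} (hpos : ∀ x : ℝ, 0 ≤ x → 0 < f x)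
    (hanti : AntitoneOn f (Set.Ici 0)) {x y : ℝ} (hx : 0 ≤ x) (hxy : x ≤ y) :
    |Sfun f y - Sfun f x| ≤ (y - x) * f x := by
  rw [abs_Sfun_sub hpos hanti hx hxy]
  calc ∫ t in Set.Ioc x y, f t ≤ ∫ _ in Set.Ioc x y, f x :=
        setIntegral_mono_on (hanti.integrableOn_Ioc_of_nonneg hx) (by simp) measurableSet_Ioc
          fun t ht => hanti hx (hx.trans ht.1.le) ht.1.le
    _ = (y - x) * f x := by simp [Measure.real, hxy]

theorem le_abs_Sfun_sub {f : ℝ → ℝ} (hpos : ∀ x : ℝ, 0 ≤ x → 0 < f x)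
    (hanti : AntitoneOn f (Set.Ici 0)) {x y z : ℝ} (hx : 0 ≤ x) (hxy : x ≤ y) (hyz : y ≤ z) :
    (y - x) * f y ≤ |Sfun f z - Sfun f x| := by
  rw [abs_Sfun_sub hpos hanti hx (hxy.trans hyz)]
  calc (y - x) * f y = ∫ _ in Set.Ioc x y, f y := by simp [Measure.real, hxy]
    _ ≤ ∫ t in Set.Ioc x y, f t :=
        setIntegral_mono_on (by simp) (hanti.integrableOn_Ioc_of_nonneg hx) measurableSet_Ioc
          fun t ht => hanti (hx.trans ht.1.le) (hx.trans hxy) ht.2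
    _ ≤ ∫ t in Set.Ioc x z, f t :=
        setIntegral_mono_set (hanti.integrableOn_Ioc_of_nonneg hx)
          ((ae_restrict_iff' measurableSet_Ioc).2 (ae_of_all _ fun t ht =>
            (hpos t (hx.trans ht.1.le)).le))
          (Set.Ioc_subset_Ioc_right hyz).eventuallyLE

theorem Sfun_pos {f : ℝ → ℝ} (hpos : ∀ x : ℝ, 0 ≤ x → 0 < f x)
    (hanti : AntitoneOn f (Set.Ici 0)) {x : ℝ} (hx : 0 < x) : 0 < Sfun f x := by
  unfold Sfun
  split_ifs with h
  · refine (setIntegral_pos_iff_support_of_nonneg_ae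
      ((ae_restrict_iff' measurableSet_Ioi).2 (ae_of_all _ fun t ht =>
        (hpos t (hx.le.trans (le_of_lt ht))).le)) (h.mono_set (Set.Ioi_subset_Ioi hx.le))).2 ?_
    have hsupp : Set.Ioi x ⊆ Function.support f := fun t ht =>
      (hpos t (hx.le.trans (le_of_lt ht))).ne'
    rw [Set.inter_eq_right.2 hsupp]
    simp
  · refine (setIntegral_pos_iff_support_of_nonneg_ae
      ((ae_restrict_iff' measurableSet_Ioc).2 (ae_of_all _ fun t ht =>
        (hpos t (le_of_lt ht.1)).le)) (hanti.integrableOn_Ioc_of_nonneg le_rfl)).2 ?_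
    have hsupp : Set.Ioc 0 x ⊆ Function.support f := fun t ht => (hpos t ht.1.le).ne'
    rw [Set.inter_eq_right.2 hsupp]
    simpa using hx

theorem tendsto_Sfun_atTop {f : ℝ → ℝ} (hpos : ∀ x : ℝ, 0 ≤ x → 0 < f x)
    (hanti : AntitoneOn f (Set.Ici 0)) (h : ¬ IntegrableOn f (Set.Ioi (0 : ℝ))) :
    Tendsto (Sfun f) atTop atTop := by
  refine tendsto_atTop.2 fun B => ?_
  by_contra hB
  refine h (integrableOn_Ioi_of_intervalIntegral_norm_bounded (l := atTop) (b := id) B 0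
    (fun y => hanti.integrableOn_Ioc_of_nonneg le_rfl) tendsto_id ?_)
  filter_upwards [eventually_ge_atTop 0] with x hx
  obtain ⟨y, hxy, hy⟩ := (not_eventually.1 hB).forall_exists_of_atTop x
  have h1 : ∫ t in (0 : ℝ)..id x, ‖f t‖ = ∫ t in Set.Ioc 0 x, f t := by
    rw [id, intervalIntegral.integral_of_le hx]
    refine setIntegral_congr_fun measurableSet_Ioc fun t ht => ?_
    exact Real.norm_of_nonneg (hpos t ht.1.le).le
  have h2 : ∫ t in Set.Ioc 0 x, f t ≤ ∫ t in Set.Ioc 0 y, f t :=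
    setIntegral_mono_set (hanti.integrableOn_Ioc_of_nonneg le_rfl)
          ((ae_restrict_iff' measurableSet_Ioc).2 (ae_of_all _ fun t ht => (hpos t ht.1.le).le))
          (Set.Ioc_subset_Ioc_right hxy).eventuallyLE
  rw [h1]
  rw [Sfun, if_neg h] at hy
  linarith

theorem tendsto_Sfun_ratio {f : ℝ → ℝ} (hpos : ∀ x : ℝ, 0 ≤ x → 0 < f x)
    (hanti : AntitoneOn f (Set.Ici 0)) {q : ℝ}
    (hq : Tendsto (fun x => 2 * f (2 * x) / f x) atTop (nhds q)) :
    Tendsto (fun x => Sfun f (2 * x) / Sfun f x) atTop (nhds q) := by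
  have hanti2 : AntitoneOn (fun t => f (2 * t)) (Set.Ici 0) := fun a ha b hb hab => by
    rw [Set.mem_Ici] at ha hb
    exact hanti (Set.mem_Ici.2 (by positivity)) (Set.mem_Ici.2 (by positivity)) (by linarith)
  have hpoint : ∀ ε > 0, ∃ T ≥ (0 : ℝ), ∀ t ≥ T, ‖2 * f (2 * t) - q * f t‖ ≤ ε * f t := by
    intro ε hε
    obtain ⟨T, hT⟩ := eventually_atTop.1 (Metric.tendsto_nhds.1 hq ε hε)
    refine ⟨max T 0, le_max_right _ _, fun t ht => ?_⟩
    have ht0 := hpos t ((le_max_right _ _).trans ht)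
    have := hT t ((le_max_left _ _).trans ht)
    rw [Real.dist_eq] at this
    have he : 2 * f (2 * t) - q * f t = (2 * f (2 * t) / f t - q) * f t := by field_simp
    rw [he, norm_mul, Real.norm_eq_abs, Real.norm_of_nonneg ht0.le]
    gcongr
  suffices hmain : ∀ ε > 0, ∀ᶠ x in atTop, |Sfun f (2 * x) - q * Sfun f x| ≤ ε * Sfun f x by
    refine Metric.tendsto_nhds.2 fun ε hε => ?_
    filter_upwards [hmain (ε / 2) (by positivity), eventually_gt_atTop 0] with x hx hx0
    have hS := Sfun_pos hpos hanti hx0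
    have he : Sfun f (2 * x) / Sfun f x - q = (Sfun f (2 * x) - q * Sfun f x) / Sfun f x := by
      field_simp
    rw [Real.dist_eq, he, abs_div, abs_of_pos hS, div_lt_iff₀ hS]
    nlinarith
  intro ε hε
  by_cases h : IntegrableOn f (Set.Ioi (0 : ℝ))
  · obtain ⟨T, hT0, hT⟩ := hpoint ε hε
    filter_upwards [eventually_ge_atTop T] with x hx
    have hx0 := hT0.trans hx
    simp only [Sfun, if_pos h]
    have hf := h.mono_set (Set.Ioi_subset_Ioi hx0)
    have hf2 : IntegrableOn (fun t => f (2 * t)) (Set.Ioi x) :=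
      (integrableOn_Ioi_comp_mul_left_iff f x two_pos).2
        (h.mono_set (Set.Ioi_subset_Ioi (by positivity)))
    have hsub : ∫ t in Set.Ioi (2 * x), f t = ∫ t in Set.Ioi x, 2 * f (2 * t) := by
      rw [integral_const_mul, integral_comp_mul_left_Ioi f x two_pos]
      simp
    rw [hsub, ← integral_const_mul, ← integral_sub (hf2.const_mul 2) (hf.const_mul q),
      ← integral_const_mul, ← Real.norm_eq_abs]
    exact norm_integral_le_of_norm_le (hf.const_mul ε)
      ((ae_restrict_iff' measurableSet_Ioi).2 (ae_of_all _ fun t ht => hT t (hx.trans ht.le)))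
  · obtain ⟨T, hT0, hT⟩ := hpoint (ε / 2) (by positivity)
    have hSinf := tendsto_Sfun_atTop hpos hanti h
    set C := |∫ t in Set.Ioc 0 T, (2 * f (2 * t) - q * f t)|
    filter_upwards [eventually_ge_atTop T, hSinf.eventually_ge_atTop (C / (ε / 2))] with x hx hC
    have hx0 := hT0.trans hx
    rw [div_le_iff₀ (by positivity)] at hC
    simp only [Sfun, if_neg h] at hC ⊢
    have hf : ∀ {a b : ℝ}, 0 ≤ a → IntegrableOn f (Set.Ioc a b) :=
      fun ha => hanti.integrableOn_Ioc_of_nonneg ha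
    have hf2 : ∀ {a b : ℝ}, 0 ≤ a → IntegrableOn (fun t => f (2 * t)) (Set.Ioc a b) :=
      fun ha => hanti2.integrableOn_Ioc_of_nonneg ha
    have hsub : ∫ t in Set.Ioc 0 (2 * x), f t = ∫ t in Set.Ioc 0 x, 2 * f (2 * t) := by
      rw [integral_const_mul, ← intervalIntegral.integral_of_le hx0,
        ← intervalIntegral.integral_of_le (by positivity),
        intervalIntegral.integral_comp_mul_left f two_ne_zero]
      simp
    have htail : |∫ t in Set.Ioc T x, (2 * f (2 * t) - q * f t)| ≤
        ∫ t in Set.Ioc T x, ε / 2 * f t := by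
      rw [← Real.norm_eq_abs]
      exact norm_integral_le_of_norm_le ((hf hT0).const_mul _)
        ((ae_restrict_iff' measurableSet_Ioc).2 (ae_of_all _ fun t ht => hT t ht.1.le))
    have hmono : ∫ t in Set.Ioc T x, f t ≤ ∫ t in Set.Ioc 0 x, f t :=
      setIntegral_mono_set (hf le_rfl)
          ((ae_restrict_iff' measurableSet_Ioc).2 (ae_of_all _ fun t ht => (hpos t ht.1.le).le))
          (Set.Ioc_subset_Ioc_left hT0).eventuallyLE
    rw [integral_const_mul] at htail
    have hh : ∀ {a b : ℝ}, 0 ≤ a → IntegrableOn (fun t => 2 * f (2 * t) - q * f t) (Set.Ioc a b) :=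
      fun ha => ((hf2 ha).const_mul 2).sub ((hf ha).const_mul q)
    have hsplit : ∫ t in Set.Ioc 0 x, (2 * f (2 * t) - q * f t) =
        (∫ t in Set.Ioc 0 T, (2 * f (2 * t) - q * f t)) +
          ∫ t in Set.Ioc T x, (2 * f (2 * t) - q * f t) := by
      rw [← Set.Ioc_union_Ioc_eq_Ioc hT0 hx, setIntegral_union
        (Set.Ioc_disjoint_Ioc_of_le le_rfl) measurableSet_Ioc (hh le_rfl) (hh hT0)]
    rw [hsub, ← integral_const_mul, ← integral_sub ((hf2 le_rfl).const_mul 2)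
      ((hf le_rfl).const_mul q), hsplit]
    refine (abs_add_le _ _).trans ?_
    have := mul_le_mul_of_nonneg_left hmono (half_pos hε).le
    change C + _ ≤ _
    linarith

theorem eccentric_iff_of_tendsto_ratio {f : ℝ → ℝ} (hpos : ∀ x : ℝ, 0 ≤ x → 0 < f x)
    (hanti : AntitoneOn f (Set.Ici 0)) {K : ℝ} (hK : 0 < K)
    (hratio : Tendsto (fun x => f x / f (2 * x)) atTop (nhds K)) :
    Eccentric f ↔ K = 2 := by
  have hinv : Tendsto (fun x => f (2 * x) / f x) atTop (nhds K⁻¹) := by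
    simpa using hratio.inv₀ hK.ne'
  have hS : Tendsto (fun x => Sfun f (2 * x) / Sfun f x) atTop (nhds (2 * K⁻¹)) :=
    tendsto_Sfun_ratio hpos hanti (by simpa only [mul_div_assoc] using hinv.const_mul 2)
  constructor
  · rintro ⟨l, hl, hcl⟩
    by_contra hne
    have hq : 2 * K⁻¹ - 1 ≠ 0 := fun h => hne (by field_simp at h; linarith)
    set m := min l 2
    have hm : 0 < m - 1 := sub_pos.2 (lt_min hl one_lt_two)
    have hlow := ((hinv.const_mul (m - 1)).mul (hS.sub_const 1).abs)
    have hc : 0 < (m - 1) * K⁻¹ * |2 * K⁻¹ - 1| := by positivity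
    set c := (m - 1) * K⁻¹ * |2 * K⁻¹ - 1|
    have hfar : ∀ᶠ x in atTop, c / 2 < |Sfun f (l * x) / Sfun f x - 1| := by
      filter_upwards [hlow.eventually (lt_mem_nhds (half_lt_self hc)),
        eventually_gt_atTop 0] with x hx hx0
      refine hx.trans_le ?_
      have hSx := Sfun_pos hpos hanti hx0
      have hfx := hpos x hx0.le
      have hf2x := hpos (2 * x) (by positivity)
      have hdiv : ∀ y, Sfun f y / Sfun f x - 1 = (Sfun f y - Sfun f x) / Sfun f x := by
        intro y; field_simp
      rw [hdiv, hdiv, abs_div, abs_div, abs_of_pos hSx]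
      have hup := abs_Sfun_sub_le hpos hanti hx0.le (show x ≤ 2 * x by linarith)
      have hdn := le_abs_Sfun_sub hpos hanti hx0.le (show x ≤ m * x by nlinarith)
        (show m * x ≤ l * x by gcongr; exact min_le_left _ _)
      have hmf : f (2 * x) ≤ f (m * x) := by
        refine hanti (Set.mem_Ici.2 (by nlinarith)) (Set.mem_Ici.2 (by positivity)) ?_
        gcongr; exact min_le_right _ _
      rw [← mul_div_assoc]
      refine div_le_div_of_nonneg_right ?_ hSx.le
      calc (m - 1) * (f (2 * x) / f x) * |Sfun f (2 * x) - Sfun f x|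
          ≤ (m - 1) * (f (2 * x) / f x) * ((2 * x - x) * f x) := by gcongr
        _ = (m * x - x) * f (2 * x) := by field_simp; ring
        _ ≤ (m * x - x) * f (m * x) := by
            gcongr
            nlinarith
        _ ≤ _ := hdn
    have hnear : ∃ᶠ x in atTop, |Sfun f (l * x) / Sfun f x - 1| < c / 2 :=
      hcl.frequently (p := fun y => |y - 1| < c / 2) (Metric.ball_mem_nhds 1 (half_pos hc))
    obtain ⟨x, h1, h2⟩ := (hnear.and_eventually hfar).exists
    exact lt_asymm h1 h2
  · rintro rfl
    refine ⟨2, one_lt_two, Tendsto.mapClusterPt ?_⟩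
    simpa using hS

/-- Proposition 2.7 (`Prop:unique`, function version): if `μ ∈ M` is strictly positive and
`lim_{x→∞} μ(x)/μ(2x) = L ∈ (1,∞)` exists, then `δ̲(μ) = δ̄(μ) = log 2/log L`; consequently
`log 2/log L` is the unique `γ > 0` such that `μ^γ` is eccentric. -/
theorem stmt12 (μ : ℝ → ℝ)
    (hpos : ∀ x : ℝ, 0 ≤ x → 0 < μ x)
    (hanti : AntitoneOn μ (Set.Ici 0))
    (hrc : ∀ x : ℝ, 0 ≤ x → ContinuousWithinAt μ (Set.Ici x) x)
    (hlim : Tendsto μ atTop (nhds 0))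
    (L : ℝ) (hL : 1 < L)
    (hratio : Tendsto (fun x : ℝ => μ x / μ (2 * x)) atTop (nhds L)) :
    IsDeltaLow μ (ENNReal.ofReal (Real.log 2 / Real.log L)) ∧
    IsDeltaUp μ (ENNReal.ofReal (Real.log 2 / Real.log L)) ∧
    ∀ γ : ℝ, 0 < γ →
      (Eccentric (fun x => μ x ^ γ) ↔ γ = Real.log 2 / Real.log L) := by
  have hL0 : 0 < L := by linarith
  have hlogL := Real.log_pos hL
  have hlog2 := Real.log_pos (one_lt_two (α := ℝ))
  have hinv : ENNReal.ofReal (Real.log 2 / Real.log L) =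
      (ENNReal.ofReal (Real.log L / Real.log 2))⁻¹ := by
    rw [← ENNReal.ofReal_inv_of_pos (by positivity), inv_div]
  obtain ⟨hinf, hsup⟩ := tendsto_ratioInf_and_ratioSup hpos hanti hL hratio
  refine ⟨⟨_, hinv, hsup⟩, ⟨_, hinv, hinf⟩, fun γ hγ => ?_⟩
  have hratioγ : Tendsto (fun x => μ x ^ γ / μ (2 * x) ^ γ) atTop (nhds (L ^ γ)) := by
    refine (hratio.rpow_const (Or.inl hL0.ne')).congr' ?_
    filter_upwards [eventually_ge_atTop 0] with x hx
    exact Real.div_rpow (hpos x hx).le (hpos (2 * x) (by positivity)).le γ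
  rw [eccentric_iff_of_tendsto_ratio (fun x hx => Real.rpow_pos_of_pos (hpos x hx) γ)
    (fun x hx y hy hxy => Real.rpow_le_rpow (hpos y hy).le (hanti hx hy hxy) hγ.le)
    (Real.rpow_pos_of_pos hL0 γ) hratioγ, eq_div_iff hlogL.ne', ← Real.log_rpow hL0]
  exact ⟨fun h => by rw [h],
    fun h => Real.log_injOn_pos (Real.rpow_pos_of_pos hL0 γ) (Set.mem_Ioi.2 two_pos) h⟩
end

section
/- Let φ : 𝒞 → [0,∞] be additive, positively homogeneous, monotone with respect to pointwise order, and dilation invariant. Let p, q ∈ (1,∞) with 1/p + 1/q = 1, and let ρ, μ, ν ∈ 𝒞 satisfy ρ((α+β)t) ≤ μ(αt)·ν(βt) for all α, β, t > 0, with φ(μ^p) < ∞ and φ(ν^q) < ∞. Then φ(ρ) ≤ C_p · φ(μ^p)^{1/p} · φ(ν^q)^{1/q}, where C_p := 1 + 2√(p−1)/p ∈ [1,2]. (This is the Hölder inequality for an arbitrary singular trace τ_ω on B(H): every singular trace is of the form τ_ω(a) = φ(μ_a) for such a functional φ applied to the eigenvalue function μ_a, and ρ = μ_{|ab|}, μ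 = μ_a, ν = μ_b satisfy the displayed submultiplicativity.) -/
open Filter MeasureTheory

/-- Membership in the cone `𝒞` of non-increasing, right-continuous functions
`[0,∞) → [0,∞)` (modelled as functions on `ℝ`, with the conditions imposed on `[0,∞)`). -/
def InCone (μ : ℝ → ℝ) : Prop :=
  (∀ x, 0 ≤ μ x) ∧ AntitoneOn μ (Set.Ici 0) ∧
    ∀ x : ℝ, 0 ≤ x → ContinuousWithinAt μ (Set.Ici x) x

namespace InCone

variable {f g : ℝ → ℝ}

theorem add (hf : InCone f) (hg : InCone g) : InCone (fun t => f t + g t) :=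
  ⟨fun x => add_nonneg (hf.1 x) (hg.1 x), hf.2.1.add hg.2.1,
    fun x hx => (hf.2.2 x hx).add (hg.2.2 x hx)⟩

theorem const_mul (hf : InCone f) {c : ℝ} (hc : 0 ≤ c) : InCone (fun t => c * f t) :=
  ⟨fun x => mul_nonneg hc (hf.1 x),
    fun _ hx _ hy hxy => mul_le_mul_of_nonneg_left (hf.2.1 hx hy hxy) hc,
    fun x hx => (hf.2.2 x hx).const_mul c⟩

theorem dilate (hf : InCone f) {a : ℝ} (ha : 0 ≤ a) : InCone (fun t => f (a * t)) := by
  refine ⟨fun x => hf.1 _, fun x hx y hy hxy => ?_, fun x hx => ?_⟩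
  · exact hf.2.1 (mul_nonneg ha hx) (mul_nonneg ha hy) (mul_le_mul_of_nonneg_left hxy ha)
  · exact (hf.2.2 (a * x) (mul_nonneg ha hx)).comp
      (continuous_const.mul continuous_id).continuousWithinAt
      fun y hy => mul_le_mul_of_nonneg_left hy ha

theorem rpow (hf : InCone f) {r : ℝ} (hr : 0 ≤ r) : InCone (fun t => f t ^ r) :=
  ⟨fun x => Real.rpow_nonneg (hf.1 x) r,
    fun _ hx y hy hxy => Real.rpow_le_rpow (hf.1 y) (hf.2.1 hx hy hxy) hr,
    fun x hx => (hf.2.2 x hx).rpow_const (Or.inr hr)⟩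

/-- By right-continuity, an inequality on `(0,∞)` between elements of the cone extends to `0`. -/
theorem le_of_forall_pos (hf : InCone f) (hg : InCone g) (h : ∀ t, 0 < t → f t ≤ g t)
    (t : ℝ) (ht : 0 ≤ t) : f t ≤ g t := by
  have key : ∀ {k : ℝ → ℝ}, InCone k → Tendsto k (nhdsWithin t (Set.Ioi t)) (nhds (k t)) :=
    fun hk => (hk.2.2 t ht).mono Set.Ioi_subset_Ici_self
  refine le_of_tendsto_of_tendsto (key hf) (key hg) ?_
  filter_upwards [self_mem_nhdsWithin] with x hx
  exact h x (ht.trans_lt hx)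

end InCone

/-- Young's inequality in the form normalised by two positive scales `A` and `B`. -/
theorem mul_le_scaled_young {p q A B x y : ℝ} (hp : 0 < p) (hq : 0 < q)
    (hpq : 1 / p + 1 / q = 1) (hA : 0 < A) (hB : 0 < B) (hx : 0 ≤ x) (hy : 0 ≤ y) :
    x * y ≤ A ^ (1 / p) * B ^ (1 / q) / (p * A) * x ^ p +
      A ^ (1 / p) * B ^ (1 / q) / (q * B) * y ^ q := by
  have hxp : 0 ≤ x ^ p := Real.rpow_nonneg hx p
  have hyq : 0 ≤ y ^ q := Real.rpow_nonneg hy q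
  have h := Real.geom_mean_le_arith_mean2_weighted (one_div_nonneg.2 hp.le)
    (one_div_nonneg.2 hq.le) (div_nonneg hxp hA.le) (div_nonneg hyq hB.le) hpq
  rw [Real.div_rpow hxp hA.le, Real.div_rpow hyq hB.le, ← Real.rpow_mul hx, ← Real.rpow_mul hy,
    mul_one_div_cancel hp.ne', mul_one_div_cancel hq.ne', Real.rpow_one, Real.rpow_one] at h
  have hA' : 0 < A ^ (1 / p) := Real.rpow_pos_of_pos hA _
  have hB' : 0 < B ^ (1 / q) := Real.rpow_pos_of_pos hB _
  calc x * y = A ^ (1 / p) * B ^ (1 / q) * (x / A ^ (1 / p) * (y / B ^ (1 / q))) := by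
        field_simp
    _ ≤ A ^ (1 / p) * B ^ (1 / q) * (1 / p * (x ^ p / A) + 1 / q * (y ^ q / B)) :=
        mul_le_mul_of_nonneg_left h (by positivity)
    _ = _ := by field_simp

/-- The exponential of the Shannon entropy of `(1/p, 1/q)` is at most that of its Rényi entropy
of order `1/2`. -/
theorem rpow_inv_mul_rpow_inv_le {p q : ℝ} (hp : 1 < p) (hq : 0 < q) (hpq : 1 / p + 1 / q = 1) :
    p ^ (1 / p) * q ^ (1 / q) ≤ 1 + 2 * Real.sqrt (p - 1) / p := by
  have hp0 : 0 < p := one_pos.trans hp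
  have h := Real.geom_mean_le_arith_mean2_weighted (one_div_nonneg.2 hp0.le)
    (one_div_nonneg.2 hq.le) (Real.sqrt_nonneg p) (Real.sqrt_nonneg q) hpq
  have hsq := mul_self_le_mul_self (by positivity) h
  have hl : (√p ^ (1 / p) * √q ^ (1 / q)) * (√p ^ (1 / p) * √q ^ (1 / q)) =
      p ^ (1 / p) * q ^ (1 / q) := by
    rw [mul_mul_mul_comm, ← Real.mul_rpow (Real.sqrt_nonneg p) (Real.sqrt_nonneg p),
      ← Real.mul_rpow (Real.sqrt_nonneg q) (Real.sqrt_nonneg q), Real.mul_self_sqrt hp0.le,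
      Real.mul_self_sqrt hq.le]
  have hpq' : p * q = p + q := by
    field_simp at hpq
    linarith
  have hs : √p * √q = q * √(p - 1) := by
    rw [← Real.sqrt_mul hp0.le, show p * q = q ^ 2 * (p - 1) by linear_combination (-q) * hpq',
      Real.sqrt_mul (sq_nonneg q), Real.sqrt_sq hq.le]
  have hr : (1 / p * √p + 1 / q * √q) * (1 / p * √p + 1 / q * √q) =
      1 + 2 * √(p - 1) / p := by
    calc _ = (√p * √p) / p ^ 2 + 2 * (√p * √q) / (p * q) + (√q * √q) / q ^ 2 := by
          field_simp
          ring
      _ = 1 / p + 1 / q + 2 * √(p - 1) / p := by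
          rw [hs, Real.mul_self_sqrt hp0.le, Real.mul_self_sqrt hq.le]
          field_simp
          ring
      _ = _ := by rw [hpq]
  rwa [hl, hr] at hsq

/-- H\"older inequality for arbitrary singular traces. Every singular trace on `B(H)` is
of the form `τ_ω(a) = φ(μ_a)` with `φ` additive, positively homogeneous, monotone and
dilation invariant on the cone `𝒞`; if `ρ, μ, ν ∈ 𝒞` satisfy the submultiplicativity
`ρ((α+β)t) ≤ μ(αt)·ν(βt)` (`α,β,t > 0`) — as do `μ_{|ab|}, μ_a, μ_b` — and `p, q ∈ (1,∞)`
are conjugate, then `φ(ρ) ≤ C_p·φ(μ^p)^{1/p}·φ(ν^q)^{1/q}` with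
`C_p = 1 + 2√(p-1)/p ∈ [1,2]`. -/
theorem stmt16 (φ : (ℝ → ℝ) → ENNReal)
    (hadd : ∀ μ ν, InCone μ → InCone ν → φ (fun t => μ t + ν t) = φ μ + φ ν)
    (hhom : ∀ (c : ℝ), 0 < c → ∀ μ, InCone μ →
      φ (fun t => c * μ t) = ENNReal.ofReal c * φ μ)
    (hmono : ∀ μ ν, InCone μ → InCone ν → (∀ t : ℝ, 0 ≤ t → μ t ≤ ν t) → φ μ ≤ φ ν)
    (hdil : ∀ (a : ℝ), 0 < a → ∀ μ, InCone μ →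
      ENNReal.ofReal a * φ (fun t => μ (a * t)) = φ μ)
    (p q : ℝ) (hp : 1 < p) (hq : 1 < q) (hpq : 1 / p + 1 / q = 1)
    (ρ μ ν : ℝ → ℝ) (hρ : InCone ρ) (hμ : InCone μ) (hν : InCone ν)
    (hsub : ∀ a b t : ℝ, 0 < a → 0 < b → 0 < t → ρ ((a + b) * t) ≤ μ (a * t) * ν (b * t))
    (hμp : φ (fun t => μ t ^ p) < ⊤) (hνq : φ (fun t => ν t ^ q) < ⊤) :
    φ ρ ≤ ENNReal.ofReal (1 + 2 * Real.sqrt (p - 1) / p) *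
        (φ (fun t => μ t ^ p)) ^ (1 / p) * (φ (fun t => ν t ^ q)) ^ (1 / q) ∧
      1 ≤ 1 + 2 * Real.sqrt (p - 1) / p ∧ 1 + 2 * Real.sqrt (p - 1) / p ≤ 2 := by
  have hp0 : 0 < p := one_pos.trans hp
  have hq0 : 0 < q := one_pos.trans hq
  have hC : 0 ≤ 2 * √(p - 1) / p := by positivity
  refine ⟨?_, by linarith, ?_⟩
  swap
  · have h1 : 2 * √(p - 1) / p ≤ 1 := by
      rw [div_le_one hp0]
      nlinarith [sq_nonneg (√(p - 1) - 1), Real.sq_sqrt (sub_nonneg.2 hp.le)]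
    linarith
  have hμc := hμ.rpow hp0.le
  have hνc := hν.rpow hq0.le
  have hdil' : ∀ r : ℝ, 0 < r → ∀ f, InCone f →
      φ (fun t => f (1 / r * t)) = ENNReal.ofReal r * φ f := by
    intro r hr f hf
    rw [← hdil (1 / r) (one_div_pos.2 hr) f hf, ← mul_assoc, ← ENNReal.ofReal_mul hr.le,
      mul_one_div_cancel hr.ne', ENNReal.ofReal_one, one_mul]
  obtain ⟨a, ha, hμa⟩ : ∃ a : ℝ, 0 ≤ a ∧ φ (fun t => μ t ^ p) = ENNReal.ofReal a :=
    ⟨_, ENNReal.toReal_nonneg, (ENNReal.ofReal_toReal hμp.ne).symm⟩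
  obtain ⟨b, hb, hνb⟩ : ∃ b : ℝ, 0 ≤ b ∧ φ (fun t => ν t ^ q) = ENNReal.ofReal b :=
    ⟨_, ENNReal.toReal_nonneg, (ENNReal.ofReal_toReal hνq.ne).symm⟩
  have hscaled : ∀ A B : ℝ, 0 < A → 0 < B →
      φ ρ ≤ ENNReal.ofReal (A ^ (1 / p) * B ^ (1 / q) * (a / A + b / B)) := by
    intro A B hA hB
    set K := A ^ (1 / p) * B ^ (1 / q) with hK
    have hK0 : 0 < K := mul_pos (Real.rpow_pos_of_pos hA _) (Real.rpow_pos_of_pos hB _)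
    have hcA : 0 < K / (p * A) := by positivity
    have hcB : 0 < K / (q * B) := by positivity
    have hdμ := hμc.dilate (one_div_nonneg.2 hp0.le)
    have hdν := hνc.dilate (one_div_nonneg.2 hq0.le)
    have hsum := (hdμ.const_mul hcA.le).add (hdν.const_mul hcB.le)
    have hle := hmono _ _ hρ hsum <| hρ.le_of_forall_pos hsum fun t ht => by
      have h := hsub (1 / p) (1 / q) t (one_div_pos.2 hp0) (one_div_pos.2 hq0) ht
      rw [hpq, one_mul] at h
      exact h.trans (mul_le_scaled_young hp0 hq0 hpq hA hB (hμ.1 _) (hν.1 _))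
    rw [hadd _ _ (hdμ.const_mul hcA.le) (hdν.const_mul hcB.le), hhom _ hcA _ hdμ,
      hhom _ hcB _ hdν, hdil' p hp0 _ hμc, hdil' q hq0 _ hνc, hμa, hνb,
      ← ENNReal.ofReal_mul hp0.le, ← ENNReal.ofReal_mul hq0.le, ← ENNReal.ofReal_mul hcA.le,
      ← ENNReal.ofReal_mul hcB.le, ← ENNReal.ofReal_add (by positivity) (by positivity)] at hle
    refine hle.trans_eq (congrArg ENNReal.ofReal ?_)
    field_simp
  have hbound : ∀ ε : ℝ, 0 < ε → φ ρ ≤ ENNReal.ofReal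
      ((1 + 2 * √(p - 1) / p) * (a + ε) ^ (1 / p) * (b + ε) ^ (1 / q)) := by
    intro ε hε
    have haε : 0 < a + ε := by positivity
    have hbε : 0 < b + ε := by positivity
    refine (hscaled (p * (a + ε)) (q * (b + ε)) (by positivity) (by positivity)).trans
      (ENNReal.ofReal_le_ofReal ?_)
    have h1 : a / (p * (a + ε)) + b / (q * (b + ε)) ≤ 1 := by
      rw [← hpq]
      refine add_le_add ?_ ?_
      · rw [div_le_div_iff₀ (by positivity) hp0]
        nlinarith
      · rw [div_le_div_iff₀ (by positivity) hq0]
        nlinarith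
    refine (mul_le_of_le_one_right (by positivity) h1).trans ?_
    rw [Real.mul_rpow hp0.le haε.le, Real.mul_rpow hq0.le hbε.le, mul_mul_mul_comm,
      mul_assoc (1 + _)]
    exact mul_le_mul_of_nonneg_right (rpow_inv_mul_rpow_inv_le hp hq0 hpq) (by positivity)
  have hlim : Tendsto (fun ε : ℝ => ENNReal.ofReal
      ((1 + 2 * √(p - 1) / p) * (a + ε) ^ (1 / p) * (b + ε) ^ (1 / q)))
      (nhdsWithin 0 (Set.Ioi 0)) (nhds (ENNReal.ofReal
      ((1 + 2 * √(p - 1) / p) * (a + 0) ^ (1 / p) * (b + 0) ^ (1 / q)))) := by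
    have hcont : Continuous fun ε : ℝ => ENNReal.ofReal
        ((1 + 2 * √(p - 1) / p) * (a + ε) ^ (1 / p) * (b + ε) ^ (1 / q)) :=
      ENNReal.continuous_ofReal.comp
        ((continuous_const.mul ((continuous_const.add continuous_id).rpow_const
          fun _ => Or.inr (one_div_nonneg.2 hp0.le))).mul
          ((continuous_const.add continuous_id).rpow_const
          fun _ => Or.inr (one_div_nonneg.2 hq0.le)))
    exact (hcont.tendsto 0).mono_left nhdsWithin_le_nhds
  have hfinal := ge_of_tendsto hlim (eventually_mem_nhdsWithin.mono hbound)
  rw [add_zero, add_zero] at hfinal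
  rwa [hμa, hνb, ENNReal.ofReal_rpow_of_nonneg ha (one_div_nonneg.2 hp0.le),
    ENNReal.ofReal_rpow_of_nonneg hb (one_div_nonneg.2 hq0.le),
    ← ENNReal.ofReal_mul (by positivity), ← ENNReal.ofReal_mul (by positivity)]
end

section
/- Let (p_k)_{k≥1} be a sequence of integers with p_k ≥ 2 and (λ_k)_{k≥1} a sequence in (0,1), uniformly generated, i.e. sup_k p_k < ∞ and sup_k p_k λ_k < 1. Set P_k := ∏_{j=1}^k p_j and Λ_k := ∏_{j=1}^k λ_j (P_0 = Λ_0 = 1), and let L := limsup_{n→∞} (Σ_{j=1}^n log p_j)/(Σ_{j=1}^n log(1/λ_j)). Then for every α > 0 the series Σ_{k=0}^∞ P_k Λ_k^α converges if α > L and diverges if α < L; that is, L is the abscissa of convergence of the zeta function Tr(|D_f|^{−α}) = 2 Σ_{k=0}^∞ P_k Λ_k^α of the filled spectral triple of the uniformly generated symmetric fractal determined by (p_k), (λ_k), and hence equals its Hausdorff dimension. -/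
open Filter

/-- If `1 ≤ p j`, `0 < lam j` and `p j * lam j ≤ 1`, the quotient of logarithmic sums lies in
`[0, 1]`. -/
theorem sum_log_div_sum_log_mem_Icc {p lam : ℕ → ℝ} (hp : ∀ k, 1 ≤ p k) (hlam : ∀ k, 0 < lam k)
    (hpl : ∀ k, p k * lam k ≤ 1) (n : ℕ) :
    (∑ j ∈ Finset.range n, Real.log (p j)) / (∑ j ∈ Finset.range n, Real.log (1 / lam j)) ∈
      Set.Icc (0 : ℝ) 1 := by
  have hA : 0 ≤ ∑ j ∈ Finset.range n, Real.log (p j) :=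
    Finset.sum_nonneg fun j _ => Real.log_nonneg (hp j)
  have hAB : ∑ j ∈ Finset.range n, Real.log (p j) ≤ ∑ j ∈ Finset.range n, Real.log (1 / lam j) :=
    Finset.sum_le_sum fun j _ => Real.log_le_log (by linarith [hp j])
      ((le_div_iff₀ (hlam j)).2 (hpl j))
  exact ⟨div_nonneg hA (hA.trans hAB), div_le_one_of_le₀ hAB (hA.trans hAB)⟩

theorem prod_mul_prod_rpow_eq_exp {p lam : ℕ → ℝ} (hp : ∀ k, 0 < p k) (hlam : ∀ k, 0 < lam k)
    (α : ℝ) (n : ℕ) :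
    (∏ j ∈ Finset.range n, p j) * (∏ j ∈ Finset.range n, lam j) ^ α =
      Real.exp ((∑ j ∈ Finset.range n, Real.log (p j)) -
        α * ∑ j ∈ Finset.range n, Real.log (1 / lam j)) := by
  have hL : 0 < ∏ j ∈ Finset.range n, lam j := Finset.prod_pos fun j _ => hlam j
  have hP : 0 < ∏ j ∈ Finset.range n, p j := Finset.prod_pos fun j _ => hp j
  simp only [one_div, Real.log_inv, Finset.sum_neg_distrib]
  rw [← Real.log_prod fun j _ => (hp j).ne', ← Real.log_prod fun j _ => (hlam j).ne',
    Real.rpow_def_of_pos hL, mul_neg, sub_neg_eq_add, Real.exp_add, Real.exp_log hP, mul_comm α]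

/-- Root-test criterion: if `B` grows at least linearly, `∑ exp (A n - α B n)` converges for
`α` above the upper limit of `A / B`. -/
theorem summable_exp_sub_of_limsup_div_lt {A B : ℕ → ℝ} {d α : ℝ} (hd : 0 < d)
    (hB : ∀ n : ℕ, n * d ≤ B n)
    (hbdd : IsBoundedUnder (· ≤ ·) atTop fun n => A n / B n)
    (h : limsup (fun n => A n / B n) atTop < α) :
    Summable fun n => Real.exp (A n - α * B n) := by
  obtain ⟨r, hr, hrα⟩ := exists_between h
  have hgeom : Summable fun n : ℕ => Real.exp (n * (-((α - r) * d))) :=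
    Real.summable_exp_nat_mul_iff.2 (neg_lt_zero.2 (mul_pos (sub_pos.2 hrα) hd))
  refine hgeom.of_norm_bounded_eventually_nat ?_
  filter_upwards [eventually_lt_of_limsup_lt hr hbdd, eventually_gt_atTop 0] with n hn hpos
  have hBpos : 0 < B n := (mul_pos (Nat.cast_pos.2 hpos) hd).trans_le (hB n)
  rw [Real.norm_of_nonneg (Real.exp_pos _).le, Real.exp_le_exp]
  have hA := (div_lt_iff₀ hBpos).1 hn
  nlinarith [mul_le_mul_of_nonneg_left (hB n) (sub_pos.2 hrα).le]

/-- `∑ exp (A n - α B n)` diverges for `α` below the upper limit of `A / B`. -/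
theorem not_summable_exp_sub_of_lt_limsup_div {A B : ℕ → ℝ} {α : ℝ}
    (hB : ∀ᶠ n in atTop, 0 < B n)
    (hbdd : IsCoboundedUnder (· ≤ ·) atTop fun n => A n / B n)
    (h : α < limsup (fun n => A n / B n) atTop) :
    ¬ Summable fun n => Real.exp (A n - α * B n) := by
  intro hs
  have hsmall := hs.tendsto_atTop_zero.eventually_lt_const one_pos
  obtain ⟨n, hn, hlt, hBpos⟩ :=
    ((frequently_lt_of_lt_limsup hbdd h).and_eventually (hsmall.and hB)).exists
  have hA := (lt_div_iff₀ hBpos).1 hn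
  rw [Real.exp_lt_one_iff] at hlt
  linarith

/-- Proposition 4.10 (filled spectral triple of a uniformly generated symmetric fractal):
let `(p_k)` be integers `≥ 2` with `sup_k p_k < ∞`, `(λ_k) ⊂ (0,1)` with
`sup_k p_k λ_k < 1`, and set `P_k = ∏_{j≤k} p_j`, `Λ_k = ∏_{j≤k} λ_j` and
`L = limsup_n (Σ_{j≤n} log p_j)/(Σ_{j≤n} log(1/λ_j))`. Then for every `α > 0` the series
`Σ_k P_k Λ_k^α` (i.e. the zeta function `Tr(|D_f|^{-α}) = 2 Σ_k P_k Λ_k^α`) converges if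
`α > L` and diverges if `α < L`; thus `L` is the abscissa of convergence of the zeta
function, i.e. the Hausdorff dimension of the triple. -/
theorem stmt19 (p : ℕ → ℕ) (lam : ℕ → ℝ)
    (hp : ∀ k, 2 ≤ p k)
    (hlam : ∀ k, 0 < lam k)
    (Pmax : ℕ) (hPmax : ∀ k, p k ≤ Pmax)
    (c : ℝ) (hc : c < 1) (hpl : ∀ k, (p k : ℝ) * lam k ≤ c) :
    ∀ α : ℝ, 0 < α →
      (Filter.limsup (fun n : ℕ =>
            (∑ j ∈ Finset.range n, Real.log (p j)) /
              (∑ j ∈ Finset.range n, Real.log (1 / lam j))) Filter.atTop < α →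
        Summable fun k : ℕ =>
          ((∏ j ∈ Finset.range k, p j : ℕ) : ℝ) * (∏ j ∈ Finset.range k, lam j) ^ α) ∧
      (α < Filter.limsup (fun n : ℕ =>
            (∑ j ∈ Finset.range n, Real.log (p j)) /
              (∑ j ∈ Finset.range n, Real.log (1 / lam j))) Filter.atTop →
        ¬ Summable fun k : ℕ =>
          ((∏ j ∈ Finset.range k, p j : ℕ) : ℝ) * (∏ j ∈ Finset.range k, lam j) ^ α) := by
  have hp1 : ∀ k, (1 : ℝ) ≤ p k := fun k => by exact_mod_cast one_le_two.trans (hp k)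
  have hp0 : ∀ k, (0 : ℝ) < p k := fun k => one_pos.trans_le (hp1 k)
  have hmem := sum_log_div_sum_log_mem_Icc hp1 hlam fun k => (hpl k).trans hc.le
  have hlog2 : 0 < Real.log 2 := Real.log_pos one_lt_two
  have hB : ∀ n : ℕ, n * Real.log 2 ≤ ∑ j ∈ Finset.range n, Real.log (1 / lam j) := fun n => by
    rw [← nsmul_eq_mul]
    nth_rw 1 [← Finset.card_range n]
    refine Finset.card_nsmul_le_sum _ _ _ fun j _ => Real.log_le_log two_pos ?_
    have h2 : (2 : ℝ) ≤ p j := by exact_mod_cast hp j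
    exact h2.trans ((le_div_iff₀ (hlam j)).2 ((hpl j).trans hc.le))
  intro α _
  simp only [Nat.cast_prod, prod_mul_prod_rpow_eq_exp hp0 hlam]
  refine ⟨fun h => summable_exp_sub_of_limsup_div_lt hlog2 hB ?_ h,
    fun h => not_summable_exp_sub_of_lt_limsup_div ?_ ?_ h⟩
  · exact isBoundedUnder_of ⟨1, fun n => (hmem n).2⟩
  · filter_upwards [eventually_gt_atTop 0] with n hn
    exact (mul_pos (Nat.cast_pos.2 hn) hlog2).trans_le (hB n)
  · exact IsBoundedUnder.isCoboundedUnder_le (isBoundedUnder_of ⟨0, fun n => (hmem n).1⟩)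
end
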